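/- Let U(1),…,U(D) ∈ U(N) be any unitaries and let 1 ≤ k' ≤ k. Then ‖Ê_{k'} − T̂_{k'}‖ ≤ ‖Ê_k − T̂_k‖. In particular, any (N,D,λ,k) quantum tensor product expander is also an (N,D,λ,k') quantum tensor product expander for all k' ≤ k. -/

import Mathlib

open scoped Matrix BigOperators
open MeasureTheory

noncomputable section

instance matMeasurableSpace (N : ℕ) : MeasurableSpace (Matrix (Fin N) (Fin N) ℂ) :=
  (inferInstance : MeasurableSpace (Fin N → Fin N → ℂ))

/-- The ℓ₂→ℓ₂ operator norm (largest singular value) of a complex matrix. -/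
def opNorm {n : Type*} [Fintype n] [DecidableEq n] (A : Matrix n n ℂ) : ℝ :=
  ‖Matrix.toEuclideanCLM (𝕜 := ℂ) A‖

/-- Entrywise complex conjugate of a matrix. -/
def conjMat {n m : Type*} (A : Matrix n m ℂ) : Matrix n m ℂ :=
  A.map (starRingEnd ℂ)

/-- The j-fold Kronecker tensor power of a matrix. -/
def tensorPow {n : Type*} [Fintype n] (A : Matrix n n ℂ) (j : ℕ) :
    Matrix (Fin j → n) (Fin j → n) ℂ :=
  Matrix.of fun i i' => ∏ a, A (i a) (i' a)

/-- Ê_j = (1/D) ∑_s U(s)^{⊗j} ⊗ (U(s)*)^{⊗j}. -/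
def EhatGen (N D j : ℕ) (U : Fin D → Matrix.unitaryGroup (Fin N) ℂ) :
    Matrix ((Fin j → Fin N) × (Fin j → Fin N)) ((Fin j → Fin N) × (Fin j → Fin N)) ℂ :=
  (D : ℂ)⁻¹ • ∑ s, Matrix.of fun p q =>
    tensorPow (U s : Matrix (Fin N) (Fin N) ℂ) j p.1 q.1 *
      tensorPow (conjMat (U s : Matrix (Fin N) (Fin N) ℂ)) j p.2 q.2

/-- T̂_j = ∫ U^{⊗j} ⊗ (U*)^{⊗j} dμ(U), defined entrywise. -/
def ThatGen (N j : ℕ) (μ : Measure (Matrix.unitaryGroup (Fin N) ℂ)) :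
    Matrix ((Fin j → Fin N) × (Fin j → Fin N)) ((Fin j → Fin N) × (Fin j → Fin N)) ℂ :=
  Matrix.of fun p q => ∫ U : Matrix.unitaryGroup (Fin N) ℂ,
    tensorPow (U : Matrix (Fin N) (Fin N) ℂ) j p.1 q.1 *
      tensorPow (conjMat (U : Matrix (Fin N) (Fin N) ℂ)) j p.2 q.2 ∂μ

/-- Averaging the blocks `M (e a ·) (e b ·)` over all `a`, `b`, with the normalisation `1 / |α|`.
This is the compression of `M` along an isometry when `e` is injective in both arguments. -/
def blockAverage {α ι κ : Type*} [Fintype α] (e : α → ι → κ) (M : Matrix κ κ ℂ) : Matrix ι ι ℂ :=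
  Matrix.of fun p q => (Fintype.card α : ℂ)⁻¹ * ∑ a, ∑ b, M (e a p) (e b q)

open scoped Matrix.Norms.L2Operator in
theorem opNorm_conjTranspose_mul_mul_le {ι κ : Type*} [Fintype ι] [DecidableEq ι] [Fintype κ]
    [DecidableEq κ] (J : Matrix κ ι ℂ) (hJ : Jᴴ * J = 1) (M : Matrix κ κ ℂ) :
    opNorm (Jᴴ * M * J) ≤ opNorm M := by
  have hone : ‖(1 : Matrix ι ι ℂ)‖ ≤ 1 := by
    have h := Matrix.l2_opNorm_conjTranspose_mul_self (1 : Matrix ι ι ℂ)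
    rw [Matrix.conjTranspose_one, Matrix.one_mul] at h
    nlinarith [norm_nonneg (1 : Matrix ι ι ℂ)]
  have hJ1 : ‖J‖ ≤ 1 := by
    have h := Matrix.l2_opNorm_conjTranspose_mul_self J
    rw [hJ] at h
    nlinarith [norm_nonneg J]
  have hJ2 : ‖Jᴴ‖ ≤ 1 := by rwa [Matrix.l2_opNorm_conjTranspose]
  change ‖Jᴴ * M * J‖ ≤ ‖M‖
  calc ‖Jᴴ * M * J‖ ≤ ‖Jᴴ * M‖ * ‖J‖ := Matrix.l2_opNorm_mul _ _
    _ ≤ ‖Jᴴ‖ * ‖M‖ * ‖J‖ := by gcongr; exact Matrix.l2_opNorm_mul _ _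
    _ ≤ 1 * ‖M‖ * 1 := by gcongr
    _ = ‖M‖ := by ring

theorem opNorm_blockAverage_le {α ι κ : Type*} [Fintype α] [Nonempty α] [Fintype ι]
    [DecidableEq ι] [Fintype κ] [DecidableEq κ] (e : α → ι → κ)
    (he : Function.Injective2 e) (M : Matrix κ κ ℂ) :
    opNorm (blockAverage e M) ≤ opNorm M := by
  classical
  set c : ℂ := (((Real.sqrt (Fintype.card α))⁻¹ : ℝ) : ℂ) with hc
  have hcc : star c = c := Complex.conj_ofReal _
  have hc2 : c * c = (Fintype.card α : ℂ)⁻¹ := by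
    rw [hc, ← Complex.ofReal_mul, ← mul_inv, Real.mul_self_sqrt (Nat.cast_nonneg _)]
    push_cast
    rfl
  let J : Matrix κ ι ℂ := Matrix.of fun x p => ∑ a, if x = e a p then c else 0
  have hcomp (A : Matrix κ κ ℂ) : Jᴴ * A * J = blockAverage e A := by
    have hl : Jᴴ * A = Matrix.of fun p x => c * ∑ a, A (e a p) x := by
      ext p x
      simp only [J, Matrix.mul_apply, Matrix.conjTranspose_apply, Matrix.of_apply, star_sum,
        Finset.sum_mul]
      rw [Finset.sum_comm, Finset.mul_sum]
      refine Finset.sum_congr rfl fun a _ => ?_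
      rw [Finset.sum_eq_single (e a p) (fun y _ hy => by simp [hy]) (by simp)]
      simp [hcc]
    rw [hl]
    ext p q
    simp only [J, blockAverage, Matrix.mul_apply, Matrix.of_apply, Finset.mul_sum]
    rw [Finset.sum_comm]
    conv_rhs => rw [Finset.sum_comm]
    refine Finset.sum_congr rfl fun b _ => ?_
    rw [Finset.sum_eq_single (e b q) (fun y _ hy => by simp [hy]) (by simp)]
    rw [if_pos rfl, Finset.sum_mul]
    refine Finset.sum_congr rfl fun a _ => ?_
    rw [← hc2]
    ring
  have hJ : Jᴴ * J = 1 := by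
    have h := hcomp 1
    rw [Matrix.mul_one] at h
    rw [h]
    ext p q
    simp only [blockAverage, Matrix.of_apply, Matrix.one_apply, he.eq_iff]
    by_cases hpq : p = q <;> simp [hpq]
  rw [← hcomp]
  exact opNorm_conjTranspose_mul_mul_le J hJ M

/-- Prepend the same index `a` to both components of a pair of tuples. -/
def consBoth {n : Type*} {j : ℕ} (a : n) (p : (Fin j → n) × (Fin j → n)) :
    (Fin (j + 1) → n) × (Fin (j + 1) → n) :=
  (Fin.cons a p.1, Fin.cons a p.2)

theorem consBoth_injective2 {n : Type*} {j : ℕ} :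
    Function.Injective2 (consBoth : n → (Fin j → n) × (Fin j → n) → _) := by
  rintro a b ⟨p, p'⟩ ⟨q, q'⟩ h
  simp only [consBoth, Prod.mk.injEq, Fin.cons_inj] at h
  exact ⟨h.1.1, Prod.ext h.1.2 h.2.2⟩

theorem tensorPow_cons {n : Type*} [Fintype n] (A : Matrix n n ℂ) {j : ℕ} (a b : n)
    (p q : Fin j → n) :
    tensorPow A (j + 1) (Fin.cons a p) (Fin.cons b q) = A a b * tensorPow A j p q := by
  simp [tensorPow, Fin.prod_univ_succ]

/-- The matrix `A^{⊗j} ⊗ (A*)^{⊗j}`. -/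
def balancedPow {n : Type*} [Fintype n] (A : Matrix n n ℂ) (j : ℕ) :
    Matrix ((Fin j → n) × (Fin j → n)) ((Fin j → n) × (Fin j → n)) ℂ :=
  Matrix.of fun p q => tensorPow A j p.1 q.1 * tensorPow (conjMat A) j p.2 q.2

theorem sum_sum_mul_conjMat {n : Type*} [Fintype n] [DecidableEq n]
    (V : Matrix.unitaryGroup n ℂ) :
    ∑ a, ∑ b, (V : Matrix n n ℂ) a b * conjMat (V : Matrix n n ℂ) a b = Fintype.card n := by
  have h := congrArg Matrix.trace (Matrix.mem_unitaryGroup_iff.mp V.2)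
  rw [Matrix.trace_one] at h
  rw [← h]
  rfl

theorem blockAverage_balancedPow {n : Type*} [Fintype n] [DecidableEq n] [Nonempty n]
    (V : Matrix.unitaryGroup n ℂ) (j : ℕ) :
    blockAverage consBoth (balancedPow (V : Matrix n n ℂ) (j + 1)) =
      balancedPow (V : Matrix n n ℂ) j := by
  ext p q
  have h (a b : n) : balancedPow (V : Matrix n n ℂ) (j + 1) (consBoth a p) (consBoth b q) =
      ((V : Matrix n n ℂ) a b * conjMat (V : Matrix n n ℂ) a b) *
        balancedPow (V : Matrix n n ℂ) j p q := by
    simp only [balancedPow, consBoth, Matrix.of_apply, tensorPow_cons]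
    ring
  simp only [blockAverage, Matrix.of_apply, h, ← Finset.sum_mul, sum_sum_mul_conjMat]
  rw [← mul_assoc, inv_mul_cancel₀ (by simp), one_mul]

theorem measurable_unitaryGroup_apply {N : ℕ} (i j : Fin N) :
    Measurable fun V : Matrix.unitaryGroup (Fin N) ℂ => (V : Matrix (Fin N) (Fin N) ℂ) i j :=
  (measurable_pi_apply j).comp ((measurable_pi_apply i).comp measurable_subtype_coe)

theorem integrable_balancedPow {N : ℕ} (μ : Measure (Matrix.unitaryGroup (Fin N) ℂ))
    [IsFiniteMeasure μ] (j : ℕ) (p q : (Fin j → Fin N) × (Fin j → Fin N)) :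
    Integrable (fun V : Matrix.unitaryGroup (Fin N) ℂ =>
      balancedPow (V : Matrix (Fin N) (Fin N) ℂ) j p q) μ := by
  refine Integrable.of_bound (C := 1) (Measurable.aestronglyMeasurable ?_) ?_
  · simp only [balancedPow, tensorPow, conjMat, Matrix.of_apply, Matrix.map_apply]
    exact (Finset.measurable_prod _ fun a _ => measurable_unitaryGroup_apply _ _).mul
      (Finset.measurable_prod _ fun a _ =>
        Complex.continuous_conj.measurable.comp (measurable_unitaryGroup_apply _ _))
  · refine Filter.Eventually.of_forall fun V => ?_
    simp only [balancedPow, tensorPow, conjMat, Matrix.of_apply, Matrix.map_apply, norm_mul,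
      norm_prod, RCLike.norm_conj]
    exact mul_le_one₀
      (Finset.prod_le_one (fun _ _ => norm_nonneg _)
        fun _ _ => entry_norm_bound_of_unitary V.2 _ _)
      (Finset.prod_nonneg fun _ _ => norm_nonneg _)
      (Finset.prod_le_one (fun _ _ => norm_nonneg _)
        fun _ _ => entry_norm_bound_of_unitary V.2 _ _)

theorem blockAverage_sub {α ι κ : Type*} [Fintype α] (e : α → ι → κ) (A B : Matrix κ κ ℂ) :
    blockAverage e (A - B) = blockAverage e A - blockAverage e B := by
  ext p q
  simp [blockAverage, Finset.sum_sub_distrib, mul_sub]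

theorem blockAverage_EhatGen {N D : ℕ} [NeZero N] (j : ℕ)
    (U : Fin D → Matrix.unitaryGroup (Fin N) ℂ) :
    blockAverage consBoth (EhatGen N D (j + 1) U) = EhatGen N D j U := by
  change blockAverage consBoth
      ((D : ℂ)⁻¹ • ∑ s, balancedPow (U s : Matrix (Fin N) (Fin N) ℂ) (j + 1)) =
    (D : ℂ)⁻¹ • ∑ s, balancedPow (U s : Matrix (Fin N) (Fin N) ℂ) j
  simp only [← blockAverage_balancedPow _ j]
  ext p q
  simp only [blockAverage, Matrix.of_apply, Matrix.smul_apply, Matrix.sum_apply, smul_eq_mul,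
    ← Finset.mul_sum]
  rw [mul_left_comm]
  congr 2
  conv_rhs => rw [Finset.sum_comm]
  exact Finset.sum_congr rfl fun a _ => Finset.sum_comm

theorem blockAverage_ThatGen {N : ℕ} [NeZero N] (j : ℕ)
    (μ : Measure (Matrix.unitaryGroup (Fin N) ℂ)) [IsFiniteMeasure μ] :
    blockAverage consBoth (ThatGen N (j + 1) μ) = ThatGen N j μ := by
  ext p q
  change (Fintype.card (Fin N) : ℂ)⁻¹ * ∑ a, ∑ b,
      ∫ V, balancedPow (V : Matrix (Fin N) (Fin N) ℂ) (j + 1) (consBoth a p) (consBoth b q) ∂μ =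
    ∫ V, balancedPow (V : Matrix (Fin N) (Fin N) ℂ) j p q ∂μ
  simp only [← blockAverage_balancedPow _ j]
  simp only [blockAverage, Matrix.of_apply]
  rw [integral_const_mul, integral_finsetSum _ fun a _ =>
    integrable_finsetSum _ fun b _ => integrable_balancedPow μ _ _ _]
  congr 1
  refine Finset.sum_congr rfl fun a _ => ?_
  rw [integral_finsetSum _ fun b _ => integrable_balancedPow μ _ _ _]

theorem opNorm_EhatGen_sub_ThatGen_le_succ {N D : ℕ} [NeZero N] (j : ℕ)
    (μ : Measure (Matrix.unitaryGroup (Fin N) ℂ)) [IsFiniteMeasure μ]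
    (U : Fin D → Matrix.unitaryGroup (Fin N) ℂ) :
    opNorm (EhatGen N D j U - ThatGen N j μ) ≤
      opNorm (EhatGen N D (j + 1) U - ThatGen N (j + 1) μ) := by
  rw [← blockAverage_EhatGen, ← blockAverage_ThatGen, ← blockAverage_sub]
  exact opNorm_blockAverage_le _ consBoth_injective2 _

/-- Monotonicity in the number of copies: a quantum k-copy tensor product
expander is also a k'-copy one for k' ≤ k, i.e. ‖Ê_{k'} − T̂_{k'}‖ ≤ ‖Ê_k − T̂_k‖. -/
theorem stmt15 (N D k k' : ℕ) (hN : 1 ≤ N) (hD : 1 ≤ D) (hk' : 1 ≤ k') (hkk : k' ≤ k)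
    (μ : Measure (Matrix.unitaryGroup (Fin N) ℂ)) [IsProbabilityMeasure μ]
    (hinv : ∀ V : Matrix.unitaryGroup (Fin N) ℂ, μ.map (fun U => V * U) = μ)
    (U : Fin D → Matrix.unitaryGroup (Fin N) ℂ) :
    opNorm (EhatGen N D k' U - ThatGen N k' μ) ≤
      opNorm (EhatGen N D k U - ThatGen N k μ) := by
  have : NeZero N := ⟨by omega⟩
  exact monotone_nat_of_le_succ
    (fun j => opNorm_EhatGen_sub_ThatGen_le_succ j μ U) hkk

end
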